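/- Let f : ℝⁿ → ℝ be convex and differentiable with L-Lipschitz gradient (L > 0), with a minimizer x* ∈ ℝⁿ. Let D be a finite set of unit vectors in ℝⁿ and μ > 0 be such that for every nonzero v ∈ ℝⁿ there exists d ∈ D with ⟨v, d⟩ ≥ μ‖v‖. Let c > 0, α > 0, x ∈ ℝⁿ and R₀ ≥ 0 with ‖x − x*‖ ≤ R₀. If f(x + αd) > f(x) − cα² for all d ∈ D, then f(x) − f(x*) ≤ R₀(L/2 + c)α/μ. -/

import Mathlib

open scoped RealInnerProductSpace

section Gradient

variable {E : Type*} [NormedAddCommGroup E] [InnerProductSpace ℝ E] [CompleteSpace E] {f : E → ℝ}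

lemma hasDerivAt_comp_line_gradient (hf : Differentiable ℝ f) (x v : E) (t : ℝ) :
    HasDerivAt (fun s : ℝ => f (x + s • v)) ⟪gradient f (x + t • v), v⟫ t := by
  have hline : HasDerivAt (fun s : ℝ => x + s • v) v t := by
    simpa using ((hasDerivAt_id t).smul_const v).const_add x
  simpa [Function.comp_def] using ((hf (x + t • v)).hasGradientAt.hasFDerivAt).comp_hasDerivAt t hline

/-- The descent lemma for functions with Lipschitz gradient. -/
lemma le_add_inner_gradient_add_sq (hf : Differentiable ℝ f) {L : ℝ}
    (hlip : ∀ x y : E, ‖gradient f x - gradient f y‖ ≤ L * ‖x - y‖) (x v : E) :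
    f (x + v) ≤ f x + ⟪gradient f x, v⟫ + L / 2 * ‖v‖ ^ 2 := by
  have hφ := hasDerivAt_comp_line_gradient hf x v
  have hB : ∀ t : ℝ, HasDerivAt
      (fun s : ℝ => f x + s * ⟪gradient f x, v⟫ + L / 2 * ‖v‖ ^ 2 * s ^ 2)
      (⟪gradient f x, v⟫ + L * ‖v‖ ^ 2 * t) t := fun t => by
    refine ((((hasDerivAt_id t).mul_const ⟪gradient f x, v⟫).const_add (f x)).add
      ((hasDerivAt_pow 2 t).const_mul (L / 2 * ‖v‖ ^ 2))).congr_deriv ?_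
    push_cast
    ring
  have hbound : ∀ t ∈ Set.Ico (0 : ℝ) 1,
      ⟪gradient f (x + t • v), v⟫ ≤ ⟪gradient f x, v⟫ + L * ‖v‖ ^ 2 * t := fun t ht => by
    have hinner := real_inner_le_norm (gradient f (x + t • v) - gradient f x) v
    have hnorm := hlip (x + t • v) x
    rw [add_sub_cancel_left, norm_smul, Real.norm_of_nonneg ht.1] at hnorm
    rw [inner_sub_left] at hinner
    nlinarith [mul_le_mul_of_nonneg_right hnorm (norm_nonneg v)]
  simpa using image_le_of_deriv_right_le_deriv_boundary
    (fun t _ => (hφ t).continuousAt.continuousWithinAt) (fun t _ => (hφ t).hasDerivWithinAt)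
    (by simp) (fun t _ => (hB t).continuousAt.continuousWithinAt)
    (fun t _ => (hB t).hasDerivWithinAt) hbound (Set.right_mem_Icc.2 zero_le_one)

lemma ConvexOn.add_inner_gradient_le (hconv : ConvexOn ℝ Set.univ f) (hf : Differentiable ℝ f)
    (x v : E) : f x + ⟪gradient f x, v⟫ ≤ f (x + v) := by
  have hφ : ConvexOn ℝ Set.univ (fun s : ℝ => f (x + s • v)) := by
    have h := hconv.comp_affineMap (AffineMap.lineMap x (x + v) : ℝ →ᵃ[ℝ] E)
    simpa [Function.comp_def, AffineMap.lineMap_apply, add_comm] using h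
  have h := hφ.le_slope_of_hasDerivAt (Set.mem_univ 0) (Set.mem_univ 1) zero_lt_one
    (hasDerivAt_comp_line_gradient hf x v 0)
  simpa [slope_def_field, le_sub_iff_add_le'] using h

end Gradient

theorem sds_convex_function_value_bound {n : ℕ} (f : EuclideanSpace ℝ (Fin n) → ℝ)
    (hconv : ConvexOn ℝ Set.univ f)
    (L : ℝ) (hL : 0 < L) (hdiff : Differentiable ℝ f)
    (hlip : ∀ x y : EuclideanSpace ℝ (Fin n), ‖gradient f x - gradient f y‖ ≤ L * ‖x - y‖)
    (xstar : EuclideanSpace ℝ (Fin n)) (hmin : ∀ y, f xstar ≤ f y)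
    (D : Finset (EuclideanSpace ℝ (Fin n))) (hDunit : ∀ d ∈ D, ‖d‖ = 1)
    (μ : ℝ) (hμ : 0 < μ)
    (hcos : ∀ v : EuclideanSpace ℝ (Fin n), v ≠ 0 → ∃ d ∈ D, μ * ‖v‖ ≤ ⟪v, d⟫)
    (c α : ℝ) (hc : 0 < c) (hα : 0 < α)
    (x : EuclideanSpace ℝ (Fin n)) (R₀ : ℝ) (hR₀ : 0 ≤ R₀) (hxR : ‖x - xstar‖ ≤ R₀)
    (hfail : ∀ d ∈ D, f (x + α • d) > f x - c * α ^ 2) :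
    f x - f xstar ≤ R₀ * (L / 2 + c) * α / μ := by
  have hgrad : μ * ‖gradient f x‖ ≤ (L / 2 + c) * α := by
    by_cases hg : gradient f x = 0
    · rw [hg, norm_zero, mul_zero]
      positivity
    · obtain ⟨d, hd, hμd⟩ := hcos (-gradient f x) (neg_ne_zero.2 hg)
      rw [norm_neg, inner_neg_left] at hμd
      have hdescent := le_add_inner_gradient_add_sq hdiff hlip x (α • d)
      rw [real_inner_smul_right, norm_smul, hDunit d hd, mul_one, Real.norm_of_nonneg hα.le]
        at hdescent
      have hstep := hfail d hd
      have hinner : -⟪gradient f x, d⟫ ≤ (L / 2 + c) * α :=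
        le_of_mul_le_mul_left (by nlinarith) hα
      exact hμd.trans hinner
  have hfirst := hconv.add_inner_gradient_le hdiff x (xstar - x)
  rw [add_sub_cancel, ← neg_sub x xstar, inner_neg_right] at hfirst
  have hinner := real_inner_le_norm (gradient f x) (x - xstar)
  rw [le_div_iff₀ hμ]
  calc (f x - f xstar) * μ ≤ (‖gradient f x‖ * ‖x - xstar‖) * μ := by gcongr; linarith
    _ ≤ (‖gradient f x‖ * R₀) * μ := by gcongr
    _ = R₀ * (μ * ‖gradient f x‖) := by ring
    _ ≤ R₀ * ((L / 2 + c) * α) := by gcongr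
    _ = R₀ * (L / 2 + c) * α := by ring
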